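/- Let φ ∈ C_V. Extend B_0φ and B̃_1φ to the totally degenerate points by setting (B_0φ)(θ_*,θ_*,θ_*) = θ_*²·φ(θ_*,θ_*,0)/2 for all θ_* ∈ [−1,0], and (B̃_1φ)(θ_*,θ_*,θ_*) = (1/2)·⨏_{−1}^{θ_*} (θ_*−t)²·(1+t−θ_*)·φ(t,θ_*,θ_*) dt. Then B̃_1φ is continuous on all of T_3, and B_0φ is continuous at every point of T_3 except possibly at (−1,0,0). -/

import Mathlib

open MeasureTheory

noncomputable section

/-- The average integral `⨏_a^b f`, with the convention `⨏_a^a f = f a`. -/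
def avg (a b : ℝ) (f : ℝ → ℝ) : ℝ :=
  if a = b then f a else (b - a)⁻¹ * ∫ x in a..b, f x

/-- The simplex `T₃ = {θ ∈ [-1,0]³ : θ₁ ≤ θ₂ ≤ θ₃}`. -/
def T3set : Set (ℝ × ℝ × ℝ) :=
  {p | -1 ≤ p.1 ∧ p.1 ≤ p.2.1 ∧ p.2.1 ≤ p.2.2 ∧ p.2.2 ≤ 0}

/-- The exceptional point `(-1, 0, 0)`. -/
def badPt : ℝ × ℝ × ℝ := (-1, 0, 0)

/-- The kernel `Φ₀`. -/
def Phi0 (t₁ t₂ θ₁ θ₂ θ₃ : ℝ) : ℝ :=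
  ((t₂ - t₁) / (θ₃ - θ₁)) * t₁ * (t₂ / (1 + θ₁ - θ₂)) * (1 + t₁ - t₂)

/-- The kernel `Φ₁`. -/
def Phi1 (t₀ t₁ t₂ θ₁ θ₃ : ℝ) : ℝ :=
  (t₁ - t₀) * ((t₂ - t₁) / (θ₃ - θ₁)) * (t₂ - t₀) * (1 + t₀ - t₁)

/-- The operator `B₀`, extended to totally degenerate points `(θ⋆,θ⋆,θ⋆)` by
`(B₀φ)(θ⋆,θ⋆,θ⋆) = θ⋆² φ(θ⋆,θ⋆,0)/2`. -/
def B0op (φ : ℝ × ℝ × ℝ → ℝ) (p : ℝ × ℝ × ℝ) : ℝ :=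
  if p.1 = p.2.2 then p.1 ^ 2 * φ (p.1, p.1, 0) / 2
  else avg p.1 p.2.1 fun t₁ => avg p.2.1 p.2.2 fun t₂ =>
    Phi0 t₁ t₂ p.1 p.2.1 p.2.2 * φ (t₁, t₂, 0)

/-- The operator `B̃₁`, extended to totally degenerate points `(θ⋆,θ⋆,θ⋆)` by
`(B̃₁φ)(θ⋆,θ⋆,θ⋆) = (1/2) ⨏_{-1}^{θ⋆} (θ⋆-t)² (1+t-θ⋆) φ(t,θ⋆,θ⋆) dt`. -/
def Bt1op (φ : ℝ × ℝ × ℝ → ℝ) (p : ℝ × ℝ × ℝ) : ℝ :=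
  if p.1 = p.2.2 then
    (1 / 2) * avg (-1) p.1 fun t => (p.1 - t) ^ 2 * (1 + t - p.1) * φ (t, p.1, p.1)
  else avg (-1) p.1 fun t₀ => avg p.1 p.2.1 fun t₁ => avg p.2.1 p.2.2 fun t₂ =>
    Phi1 t₀ t₁ t₂ p.1 p.2.2 * φ (t₀, t₁, t₂)

/-- `ν₀(θ) = -(θ₂+θ₃)/(1+θ₁-θ₂)`. -/
def nu0 (p : ℝ × ℝ × ℝ) : ℝ := -(p.2.1 + p.2.2) / (1 + p.1 - p.2.1)

/-- `ν₁(θ) = (1+θ₁)/(1+θ₁-θ₂)`. -/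
def nu1 (p : ℝ × ℝ × ℝ) : ℝ := (1 + p.1) / (1 + p.1 - p.2.1)

/-- The operator `B₁ = ν₁ ⬝ B̃₁`. -/
def B1op (φ : ℝ × ℝ × ℝ → ℝ) (p : ℝ × ℝ × ℝ) : ℝ := nu1 p * Bt1op φ p

/-- The operator `B = B₀ + B₁`. -/
def Bop3 (φ : ℝ × ℝ × ℝ → ℝ) : ℝ × ℝ × ℝ → ℝ :=
  fun p => B0op φ p + B1op φ p

/-- Membership in `C_V = C(T₃)|_{T₃ ∖ {(-1,0,0)}} ⊕ span{ν₀, ν₁}` (only the values of `φ`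
on `T₃ ∖ {(-1,0,0)}` are relevant). -/
def InCV (φ : ℝ × ℝ × ℝ → ℝ) : Prop :=
  ∃ ψ : ℝ × ℝ × ℝ → ℝ, ContinuousOn ψ T3set ∧ ∃ c₀ c₁ : ℝ,
    ∀ p ∈ T3set \ {badPt}, φ p = ψ p + c₀ * nu0 p + c₁ * nu1 p

lemma avg_eq (a b : ℝ) (f : ℝ → ℝ) : avg a b f = ∫ s in (0:ℝ)..1, f (a + s * (b - a)) := by
  unfold avg
  split_ifs with h
  · subst h; simp
  · have h' : b - a ≠ 0 := sub_ne_zero.mpr (Ne.symm h)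
    have := intervalIntegral.integral_comp_add_mul (a := 0) (b := 1) f h' a
    simp only [mul_comm _ (b - a)]
    rw [this]; simp

def rr (p : ℝ × ℝ × ℝ) : ℝ × ℝ × ℝ :=
  (max (-1) (min 0 p.1), max (max (-1) (min 0 p.1)) (min 0 p.2.1),
    max (max (max (-1) (min 0 p.1)) (min 0 p.2.1)) (min 0 p.2.2))

lemma rr_cont : Continuous rr := by unfold rr; fun_prop

lemma rr_mem (p : ℝ × ℝ × ℝ) : rr p ∈ T3set := by
  refine ⟨?_, ?_, ?_, ?_⟩ <;> simp [rr]

lemma rr_id {p : ℝ × ℝ × ℝ} (hp : p ∈ T3set) : rr p = p := by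
  obtain ⟨a, b, c⟩ := p
  obtain ⟨h1, h2, h3, h4⟩ := hp
  simp only at h1 h2 h3 h4
  have ha : min 0 a = a := min_eq_right (by linarith)
  have hb : min 0 b = b := min_eq_right (by linarith)
  have hc : min 0 c = c := min_eq_right (by linarith)
  simp [rr, ha, hb, hc, h1, h2, h3]

lemma den_ne {p : ℝ × ℝ × ℝ} (hp : p ∈ T3set \ {badPt}) : 1 + p.1 - p.2.1 ≠ 0 := by
  obtain ⟨a, b, c⟩ := p
  obtain ⟨⟨h1, h2, h3, h4⟩, hb⟩ := hp
  simp only at h1 h2 h3 h4 ⊢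
  intro h
  apply hb
  simp only [badPt, Set.mem_singleton_iff, Prod.mk.injEq]
  refine ⟨?_, ?_, ?_⟩ <;> linarith

lemma exists_G (φ : ℝ × ℝ × ℝ → ℝ) (hφ : InCV φ) :
    ∃ G : ℝ × ℝ × ℝ → ℝ, Continuous G ∧ ∀ p ∈ T3set, G p = (1 + p.1 - p.2.1) * φ p := by
  obtain ⟨ψ, hψ, c0, c1, h⟩ := hφ
  refine ⟨fun p => (1 + p.1 - p.2.1) * ψ (rr p) - c0 * (p.2.1 + p.2.2) + c1 * (1 + p.1), ?_, ?_⟩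
  · have : Continuous fun p => ψ (rr p) := hψ.comp_continuous rr_cont rr_mem
    exact (((by fun_prop : Continuous fun p : ℝ × ℝ × ℝ => 1 + p.1 - p.2.1).mul this).sub
      (by fun_prop)).add (by fun_prop)
  · intro p hp
    simp only [rr_id hp]
    by_cases hb : p = badPt
    · subst hb; simp [badPt]
    · have hm : p ∈ T3set \ {badPt} := ⟨hp, hb⟩
      have hd := den_ne hm
      rw [h p hm, nu0, nu1]
      field_simp
      ring

lemma lin1 {u v : ℝ → ℝ} (hu : Continuous u) (hv : Continuous v) (l : ℝ) :
    (∫ s in (0:ℝ)..1, (l * u s + v s)) =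
      l * (∫ s in (0:ℝ)..1, u s) + ∫ s in (0:ℝ)..1, v s := by
  rw [intervalIntegral.integral_add ((hu.const_mul l).intervalIntegrable _ _)
    (hv.intervalIntegrable _ _), intervalIntegral.integral_const_mul]

lemma parcont {X : Type*} [TopologicalSpace X] [FirstCountableTopology X] [LocallyCompactSpace X]
    {u : X → ℝ → ℝ} (hu : Continuous (Function.uncurry u)) :
    Continuous fun x => ∫ s in (0:ℝ)..1, u x s :=
  intervalIntegral.continuous_parametric_intervalIntegral_of_continuous' hu 0 1

lemma int_two (k : ℝ) : (∫ s in (0:ℝ)..1, ∫ t in (0:ℝ)..1, k * (1 - s - t)) = 0 := by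
  have h : ∀ s : ℝ, (∫ t in (0:ℝ)..1, k * (1 - s - t)) = k * (1/2 - s) := by
    intro s
    rw [intervalIntegral.integral_const_mul,
      intervalIntegral.integral_sub (by simp) (Continuous.intervalIntegrable (by fun_prop) _ _)]
    simp
    left; ring
  simp only [h]
  rw [intervalIntegral.integral_const_mul,
      intervalIntegral.integral_sub (by simp) (Continuous.intervalIntegrable (by fun_prop) _ _)]
  simp

lemma int_half (k : ℝ) : (∫ t in (0:ℝ)..1, k * t) = k / 2 := by
  rw [intervalIntegral.integral_const_mul]; simp; ring

def lam (p : ℝ × ℝ × ℝ) : ℝ := (p.2.1 - p.1) / (p.2.2 - p.1)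

lemma lam_mul {A : ℝ × ℝ × ℝ → ℝ} (hA : Continuous A) (h0 : ∀ a : ℝ, A (a, a, a) = 0) :
    ContinuousOn (fun p => lam p * A p) T3set := by
  rintro p hp
  by_cases hd : p.1 = p.2.2
  · obtain ⟨a, b, c⟩ := p
    obtain ⟨h1, h2, h3, h4⟩ := hp
    simp only at h1 h2 h3 h4 hd
    subst hd
    obtain rfl : b = a := le_antisymm h3 h2
    unfold ContinuousWithinAt
    have hA0 : Filter.Tendsto (fun p => |A p|) (nhdsWithin (b, b, b) T3set) (nhds 0) := by
      have := (hA.abs.tendsto (b, b, b)).mono_left (nhdsWithin_le_nhds (s := T3set))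
      simpa [h0] using this
    simp only [h0, mul_zero]
    apply squeeze_zero_norm' _ hA0
    filter_upwards [self_mem_nhdsWithin] with q hq
    obtain ⟨g1, g2, g3, g4⟩ := hq
    rw [Real.norm_eq_abs, abs_mul]
    have : |lam q| ≤ 1 := by
      unfold lam
      rw [abs_of_nonneg (div_nonneg (by linarith) (by linarith))]
      exact div_le_one_of_le₀ (by linarith) (by linarith)
    nlinarith [abs_nonneg (A q)]
  · have : ContinuousAt (fun p => lam p * A p) p := by
      unfold lam
      have : p.2.2 - p.1 ≠ 0 := sub_ne_zero.mpr (Ne.symm hd)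
      have hA' := hA.continuousAt (x := p)
      fun_prop (disch := assumption)
    exact this.continuousWithinAt

lemma lam_id {p : ℝ × ℝ × ℝ} (hd : p.1 ≠ p.2.2) (s t : ℝ) :
    ((p.2.1 + t * (p.2.2 - p.2.1)) - (p.1 + s * (p.2.1 - p.1))) / (p.2.2 - p.1)
      = lam p * (1 - s - t) + t := by
  have : p.2.2 - p.1 ≠ 0 := sub_ne_zero.mpr (Ne.symm hd)
  unfold lam
  field_simp
  ring

lemma cvx {a b s : ℝ} (h : a ≤ b) (hs : s ∈ Set.uIcc (0:ℝ) 1) :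
    a ≤ a + s * (b - a) ∧ a + s * (b - a) ≤ b := by
  rw [Set.uIcc_of_le zero_le_one] at hs
  obtain ⟨h0, h1⟩ := hs
  constructor <;> nlinarith

def w1 (G : ℝ × ℝ × ℝ → ℝ) (p : ℝ × ℝ × ℝ) (s0 s1 s2 : ℝ) : ℝ :=
  ((p.1 + s1 * (p.2.1 - p.1)) - (-1 + s0 * (p.1 - -1))) *
  ((p.2.1 + s2 * (p.2.2 - p.2.1)) - (-1 + s0 * (p.1 - -1))) *
  G (-1 + s0 * (p.1 - -1), p.1 + s1 * (p.2.1 - p.1), p.2.1 + s2 * (p.2.2 - p.2.1))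

def w0 (G : ℝ × ℝ × ℝ → ℝ) (p : ℝ × ℝ × ℝ) (s1 s2 : ℝ) : ℝ :=
  (p.1 + s1 * (p.2.1 - p.1)) * (p.2.1 + s2 * (p.2.2 - p.2.1)) *
  G (p.1 + s1 * (p.2.1 - p.1), p.2.1 + s2 * (p.2.2 - p.2.1), 0)

def I1 (G : ℝ × ℝ × ℝ → ℝ) (k : ℝ → ℝ → ℝ) (p : ℝ × ℝ × ℝ) : ℝ :=
  ∫ s0 in (0:ℝ)..1, ∫ s1 in (0:ℝ)..1, ∫ s2 in (0:ℝ)..1, w1 G p s0 s1 s2 * k s1 s2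

def I0 (G : ℝ × ℝ × ℝ → ℝ) (k : ℝ → ℝ → ℝ) (p : ℝ × ℝ × ℝ) : ℝ :=
  ∫ s1 in (0:ℝ)..1, ∫ s2 in (0:ℝ)..1, w0 G p s1 s2 * k s1 s2

section
variable {G : ℝ × ℝ × ℝ → ℝ} (hG : Continuous G)

lemma lin2 {u v : ℝ → ℝ → ℝ} (hu : Continuous (Function.uncurry u))
    (hv : Continuous (Function.uncurry v)) (l : ℝ) :
    (∫ s in (0:ℝ)..1, ∫ t in (0:ℝ)..1, (l * u s t + v s t)) =
      l * (∫ s in (0:ℝ)..1, ∫ t in (0:ℝ)..1, u s t) + ∫ s in (0:ℝ)..1, ∫ t in (0:ℝ)..1, v s t := by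
  rw [← lin1 (parcont hu) (parcont hv)]
  congr 1; ext s
  exact lin1 (u := u s) (v := v s) (by fun_prop) (by fun_prop) l

lemma c2 {X : Type*} [TopologicalSpace X] [FirstCountableTopology X] [LocallyCompactSpace X]
    {u : X → ℝ → ℝ → ℝ} (hu : Continuous fun q : (X × ℝ) × ℝ => u q.1.1 q.1.2 q.2) :
    Continuous fun x => ∫ s in (0:ℝ)..1, ∫ t in (0:ℝ)..1, u x s t :=
  parcont (u := fun x s => ∫ t in (0:ℝ)..1, u x s t)
    (parcont (X := X × ℝ) (u := fun q t => u q.1 q.2 t) hu)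

lemma c3 {X : Type*} [TopologicalSpace X] [FirstCountableTopology X] [LocallyCompactSpace X]
    {u : X → ℝ → ℝ → ℝ → ℝ}
    (hu : Continuous fun q : ((X × ℝ) × ℝ) × ℝ => u q.1.1.1 q.1.1.2 q.1.2 q.2) :
    Continuous fun x => ∫ r in (0:ℝ)..1, ∫ s in (0:ℝ)..1, ∫ t in (0:ℝ)..1, u x r s t :=
  parcont (u := fun x r => ∫ s in (0:ℝ)..1, ∫ t in (0:ℝ)..1, u x r s t)
    (c2 (X := X × ℝ) (u := fun q s t => u q.1 q.2 s t) hu)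

lemma lin3 {u v : ℝ → ℝ → ℝ → ℝ}
    (hu : Continuous fun q : (ℝ × ℝ) × ℝ => u q.1.1 q.1.2 q.2)
    (hv : Continuous fun q : (ℝ × ℝ) × ℝ => v q.1.1 q.1.2 q.2) (l : ℝ) :
    (∫ r in (0:ℝ)..1, ∫ s in (0:ℝ)..1, ∫ t in (0:ℝ)..1, (l * u r s t + v r s t)) =
      l * (∫ r in (0:ℝ)..1, ∫ s in (0:ℝ)..1, ∫ t in (0:ℝ)..1, u r s t) +
      ∫ r in (0:ℝ)..1, ∫ s in (0:ℝ)..1, ∫ t in (0:ℝ)..1, v r s t := by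
  rw [← lin1 (c2 hu) (c2 hv)]
  congr 1; ext r
  exact lin2 (u := u r) (v := v r)
    (hu.comp (by fun_prop : Continuous fun q : ℝ × ℝ => ((r, q.1), q.2)))
    (hv.comp (by fun_prop : Continuous fun q : ℝ × ℝ => ((r, q.1), q.2))) l

include hG in
lemma I1_cont {k : ℝ → ℝ → ℝ} (hk : Continuous (Function.uncurry k)) : Continuous (I1 G k) := by
  apply c3
  unfold w1
  have := hk.comp (by fun_prop : Continuous
    fun q : (((ℝ × ℝ × ℝ) × ℝ) × ℝ) × ℝ => (q.1.2, q.2))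
  simp only [Function.comp_def, Function.uncurry] at this
  fun_prop

include hG in
lemma I0_cont {k : ℝ → ℝ → ℝ} (hk : Continuous (Function.uncurry k)) : Continuous (I0 G k) := by
  apply c2
  unfold w0
  have := hk.comp (by fun_prop : Continuous
    fun q : ((ℝ × ℝ × ℝ) × ℝ) × ℝ => (q.1.2, q.2))
  simp only [Function.comp_def, Function.uncurry] at this
  fun_prop

lemma I1_diag (a : ℝ) : I1 G (fun s t => 1 - s - t) (a, a, a) = 0 := by
  simp only [I1, w1, sub_self, mul_zero, add_zero, int_two, intervalIntegral.integral_zero]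

lemma I0_diag (a : ℝ) : I0 G (fun s t => 1 - s - t) (a, a, a) = 0 := by
  simp only [I0, w0, sub_self, mul_zero, add_zero, int_two]

include hG in
lemma Bt1_eq {φ : ℝ × ℝ × ℝ → ℝ} (hGφ : ∀ p ∈ T3set, G p = (1 + p.1 - p.2.1) * φ p)
    {p : ℝ × ℝ × ℝ} (hp : p ∈ T3set) :
    Bt1op φ p = lam p * I1 G (fun s t => 1 - s - t) p + I1 G (fun _ t => t) p := by
  have hp' := hp
  obtain ⟨h1, h2, h3, h4⟩ := hp'
  unfold Bt1op
  split_ifs with hd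
  · obtain ⟨a, b, c⟩ := p
    simp only at h1 h2 h3 h4 hd ⊢
    subst hd
    obtain rfl : b = a := le_antisymm h3 h2
    rw [I1_diag, mul_zero, zero_add, avg_eq, I1, ← intervalIntegral.integral_const_mul]
    apply intervalIntegral.integral_congr
    intro s0 hs0
    obtain ⟨e1, e2⟩ := cvx h1 hs0
    simp only [w1, sub_self, mul_zero, add_zero, int_half, intervalIntegral.integral_const]
    rw [hGφ _ ⟨e1, e2, le_refl _, h4⟩]
    simp
    ring
  · simp only [avg_eq]
    unfold I1
    rw [← lin3]
    · apply intervalIntegral.integral_congr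
      intro s0 hs0
      apply intervalIntegral.integral_congr
      intro s1 hs1
      apply intervalIntegral.integral_congr
      intro s2 hs2
      obtain ⟨e1, e2⟩ := cvx h1 hs0
      obtain ⟨e3, e4⟩ := cvx h2 hs1
      obtain ⟨e5, e6⟩ := cvx h3 hs2
      simp only [Phi1, w1, lam_id hd]
      rw [hGφ _ ⟨e1, e2.trans e3, e4.trans e5, e6.trans h4⟩]
      simp only
      ring
    · unfold w1; fun_prop
    · unfold w1; fun_prop

include hG in
lemma B0_eq {φ : ℝ × ℝ × ℝ → ℝ} (hGφ : ∀ p ∈ T3set, G p = (1 + p.1 - p.2.1) * φ p)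
    {p : ℝ × ℝ × ℝ} (hp : p ∈ T3set) :
    B0op φ p = (1 + p.1 - p.2.1)⁻¹ *
      (lam p * I0 G (fun s t => 1 - s - t) p + I0 G (fun _ t => t) p) := by
  have hp' := hp
  obtain ⟨h1, h2, h3, h4⟩ := hp'
  unfold B0op
  split_ifs with hd
  · obtain ⟨a, b, c⟩ := p
    simp only at h1 h2 h3 h4 hd ⊢
    subst hd
    obtain rfl : b = a := le_antisymm h3 h2
    rw [I0_diag, mul_zero, zero_add, I0]
    simp only [w0, sub_self, mul_zero, add_zero, int_half, intervalIntegral.integral_const]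
    rw [hGφ _ ⟨h1, le_refl _, h4, le_refl _⟩]
    simp only [sub_zero, one_smul, add_sub_cancel_right, inv_one, one_mul]
    ring
  · simp only [avg_eq]
    unfold I0
    rw [← lin2, ← intervalIntegral.integral_const_mul]
    · apply intervalIntegral.integral_congr
      intro s1 hs1
      simp only
      rw [← intervalIntegral.integral_const_mul]
      apply intervalIntegral.integral_congr
      intro s2 hs2
      obtain ⟨e3, e4⟩ := cvx h2 hs1
      obtain ⟨e5, e6⟩ := cvx h3 hs2
      simp only [Phi0, w0, lam_id hd]
      rw [hGφ _ ⟨h1.trans e3, e4.trans e5, e6.trans h4, le_refl _⟩]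
      simp only
      ring
    · unfold w0 Function.uncurry; fun_prop
    · unfold w0 Function.uncurry; fun_prop
end

theorem statement16 (φ : ℝ × ℝ × ℝ → ℝ) (hφ : InCV φ) :
    ContinuousOn (Bt1op φ) T3set ∧
    ContinuousOn (B0op φ) (T3set \ {badPt}) := by
  obtain ⟨G, hG, hGφ⟩ := exists_G φ hφ
  have k1 : Continuous (Function.uncurry fun s t : ℝ => 1 - s - t) := by
    unfold Function.uncurry; fun_prop
  have k2 : Continuous (Function.uncurry fun _ t : ℝ => t) := by
    unfold Function.uncurry; fun_prop
  constructor
  · exact ((lam_mul (I1_cont hG k1) I1_diag).add (I1_cont hG k2).continuousOn).congr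
      fun p hp => Bt1_eq hG hGφ hp
  · refine ContinuousOn.congr ?_ fun p hp => B0_eq hG hGφ hp.1
    refine ContinuousOn.mul (ContinuousOn.inv₀ (by fun_prop) fun p hp => den_ne hp) ?_
    exact ((lam_mul (I0_cont hG k1) I0_diag).add (I0_cont hG k2).continuousOn).mono
      Set.sdiff_subset
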